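/- For every finite POMDP, every topology β on histories, every horizon L ≥ 1, every belief b₀ and every action a₀, the closed-loop optimal Q-value is upper-bounded by the adaptive fully observable optimal Q-value at the empty history: Q L b₀ a₀ ≤ Q^{AFO}_β L b₀ a₀ []. (Upper-bound half of Theorem 1.) -/

import Mathlib

open Finset

set_option maxHeartbeats 1000000

attribute [local instance] Classical.propDecidable

/-- A finite POMDP: transition kernel, observation kernel and reward. -/
structure POMDP (X A Z : Type) where
  T : X → A → PMF X
  O : X → PMF Z
  r : X → A → ℝ

namespace POMDP

variable {X A Z : Type} [Fintype X] [Fintype A] [Fintype Z]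
variable [Nonempty X] [Nonempty A] [Nonempty Z]

/-- Real-valued transition probability. -/
noncomputable def Tr (M : POMDP X A Z) (x : X) (a : A) (x' : X) : ℝ :=
  ((M.T x a) x').toReal

/-- Real-valued observation probability. -/
noncomputable def Ob (M : POMDP X A Z) (x : X) (z : Z) : ℝ :=
  ((M.O x) z).toReal

/-- A belief: nonnegative and sums to one. -/
def IsBelief (b : X → ℝ) : Prop :=
  (∀ x, 0 ≤ b x) ∧ ∑ x, b x = 1

/-- The propagated belief `b·a`. -/
noncomputable def prop (M : POMDP X A Z) (b : X → ℝ) (a : A) : X → ℝ :=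
  fun x' => ∑ x, b x * M.Tr x a x'

/-- Expected reward `R(b,a)`. -/
noncomputable def Rew (M : POMDP X A Z) (b : X → ℝ) (a : A) : ℝ :=
  ∑ x, b x * M.r x a

/-- Observation likelihood `P(z ∣ b, a)`. -/
noncomputable def obsLik (M : POMDP X A Z) (z : Z) (b : X → ℝ) (a : A) : ℝ :=
  ∑ x', M.prop b a x' * M.Ob x' z

/-- Bayes posterior `b^{a,z}`. -/
noncomputable def post (M : POMDP X A Z) (b : X → ℝ) (a : A) (z : Z) : X → ℝ :=
  fun x' => M.Ob x' z * M.prop b a x' / M.obsLik z b a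

/-- Closed-loop optimal value `V`. -/
noncomputable def V (M : POMDP X A Z) : ℕ → (X → ℝ) → ℝ
  | 0, _ => 0
  | n + 1, b =>
    Finset.univ.sup' Finset.univ_nonempty fun a =>
      M.Rew b a +
        ∑ z ∈ Finset.univ.filter (fun z => 0 < M.obsLik z b a),
          M.obsLik z b a * V M n (M.post b a z)

/-- Closed-loop optimal Q-function `Q`. -/
noncomputable def Q (M : POMDP X A Z) : ℕ → (X → ℝ) → A → ℝ
  | 0, _, _ => 0
  | n + 1, b, a =>
    M.Rew b a +
      ∑ z ∈ Finset.univ.filter (fun z => 0 < M.obsLik z b a),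
        M.obsLik z b a * V M n (M.post b a z)

/-- Open-loop optimal value `W`. -/
noncomputable def W (M : POMDP X A Z) : ℕ → (X → ℝ) → ℝ
  | 0, _ => 0
  | n + 1, b =>
    Finset.univ.sup' Finset.univ_nonempty fun a =>
      M.Rew b a + W M n (M.prop b a)

/-- Open-loop Q-function `Q^{OL}`. -/
noncomputable def QOL (M : POMDP X A Z) : ℕ → (X → ℝ) → A → ℝ
  | 0, _, _ => 0
  | n + 1, b, a => M.Rew b a + W M n (M.prop b a)

/-- Fully observable (MDP) optimal value `U`. -/
noncomputable def U (M : POMDP X A Z) : ℕ → X → ℝ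
  | 0, _ => 0
  | n + 1, x =>
    Finset.univ.sup' Finset.univ_nonempty fun a =>
      M.r x a + ∑ x', M.Tr x a x' * U M n x'

/-- QMDP Q-function `Q^{FO}`. -/
noncomputable def QFO (M : POMDP X A Z) : ℕ → (X → ℝ) → A → ℝ
  | 0, _, _ => 0
  | n + 1, b, a => M.Rew b a + ∑ x', M.prop b a x' * U M n x'

/-- Adaptive open-loop optimal value `V^{AOL}_β` on histories of actions and observations. -/
noncomputable def VAOL (M : POMDP X A Z) (β : List (A ⊕ Z) → Bool) :
    ℕ → (X → ℝ) → List (A ⊕ Z) → ℝ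
  | 0, _, _ => 0
  | n + 1, b, h =>
    Finset.univ.sup' Finset.univ_nonempty fun a =>
      M.Rew b a +
        (if β h = true then VAOL M β n (M.prop b a) (h ++ [Sum.inl a])
        else
          ∑ z ∈ Finset.univ.filter (fun z => 0 < M.obsLik z b a),
            M.obsLik z b a * VAOL M β n (M.post b a z) (h ++ [Sum.inl a, Sum.inr z]))

/-- Adaptive open-loop Q-function `Q^{AOL}_β`. -/
noncomputable def QAOL (M : POMDP X A Z) (β : List (A ⊕ Z) → Bool) :
    ℕ → (X → ℝ) → A → List (A ⊕ Z) → ℝ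
  | 0, _, _, _ => 0
  | n + 1, b, a, h =>
    M.Rew b a +
      (if β h = true then VAOL M β n (M.prop b a) (h ++ [Sum.inl a])
      else
        ∑ z ∈ Finset.univ.filter (fun z => 0 < M.obsLik z b a),
          M.obsLik z b a * VAOL M β n (M.post b a z) (h ++ [Sum.inl a, Sum.inr z]))

/-- Point-mass belief at `x'`. -/
noncomputable def delta (x' : X) : X → ℝ := fun x => if x = x' then 1 else 0

/-- Adaptive fully-observable optimal value `V^{AFO}_β` on histories of
actions, observations and states. -/
noncomputable def VAFO (M : POMDP X A Z) (β : List (A ⊕ (Z ⊕ X)) → Bool) :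
    ℕ → (X → ℝ) → List (A ⊕ (Z ⊕ X)) → ℝ
  | 0, _, _ => 0
  | n + 1, b, h =>
    Finset.univ.sup' Finset.univ_nonempty fun a =>
      M.Rew b a +
        (if β h = true then
          ∑ x', M.prop b a x' *
            VAFO M β n (delta x') (h ++ [Sum.inl a, Sum.inr (Sum.inr x')])
        else
          ∑ z ∈ Finset.univ.filter (fun z => 0 < M.obsLik z b a),
            M.obsLik z b a *
              VAFO M β n (M.post b a z) (h ++ [Sum.inl a, Sum.inr (Sum.inl z)]))

/-- Adaptive fully-observable Q-function `Q^{AFO}_β`. -/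
noncomputable def QAFO (M : POMDP X A Z) (β : List (A ⊕ (Z ⊕ X)) → Bool) :
    ℕ → (X → ℝ) → A → List (A ⊕ (Z ⊕ X)) → ℝ
  | 0, _, _, _ => 0
  | n + 1, b, a, h =>
    M.Rew b a +
      (if β h = true then
        ∑ x', M.prop b a x' *
          VAFO M β n (delta x') (h ++ [Sum.inl a, Sum.inr (Sum.inr x')])
      else
        ∑ z ∈ Finset.univ.filter (fun z => 0 < M.obsLik z b a),
          M.obsLik z b a *
            VAFO M β n (M.post b a z) (h ++ [Sum.inl a, Sum.inr (Sum.inl z)]))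

/-- Depth-indexed adaptive open-loop value. -/
noncomputable def VAOLd (M : POMDP X A Z) (β : ℕ → Bool) : ℕ → ℕ → (X → ℝ) → ℝ
  | _, 0, _ => 0
  | d, n + 1, b =>
    Finset.univ.sup' Finset.univ_nonempty fun a =>
      M.Rew b a +
        (if β d = true then VAOLd M β (d + 1) n (M.prop b a)
        else
          ∑ z ∈ Finset.univ.filter (fun z => 0 < M.obsLik z b a),
            M.obsLik z b a * VAOLd M β (d + 1) n (M.post b a z))

/-- Depth-indexed adaptive fully-observable value. -/
noncomputable def VAFOd (M : POMDP X A Z) (β : ℕ → Bool) : ℕ → ℕ → (X → ℝ) → ℝ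
  | _, 0, _ => 0
  | d, n + 1, b =>
    Finset.univ.sup' Finset.univ_nonempty fun a =>
      M.Rew b a +
        (if β d = true then
          ∑ x', M.prop b a x' * VAFOd M β (d + 1) n (delta x')
        else
          ∑ z ∈ Finset.univ.filter (fun z => 0 < M.obsLik z b a),
            M.obsLik z b a * VAFOd M β (d + 1) n (M.post b a z))

/-- Open-loop propagated beliefs `φ₀ = b`, `φ_{i+1} = φ_i · a i` along a
finite action sequence. -/
noncomputable def propFin (M : POMDP X A Z) (b : X → ℝ) {n : ℕ} (a : Fin n → A)
    (j : Fin (n + 1)) : X → ℝ :=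
  Fin.induction b (fun i ih => M.prop ih (a i)) j

end POMDP


namespace POMDP

section Aux

variable {X A Z : Type} [Fintype X] [Fintype A] [Fintype Z]
variable [Nonempty X] [Nonempty A] [Nonempty Z]

/-- Unnormalized posterior. -/
noncomputable def upost (M : POMDP X A Z) (b : X → ℝ) (a : A) (z : Z) : X → ℝ :=
  fun x' => M.Ob x' z * M.prop b a x'

/-- Unnormalized (sublinear) closed-loop value. -/
noncomputable def S (M : POMDP X A Z) : ℕ → (X → ℝ) → ℝ
  | 0, _ => 0
  | n + 1, b =>
    Finset.univ.sup' Finset.univ_nonempty fun a =>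
      M.Rew b a + ∑ z, S M n (M.upost b a z)

theorem Ob_nonneg (M : POMDP X A Z) (x : X) (z : Z) : 0 ≤ M.Ob x z :=
  ENNReal.toReal_nonneg

theorem Ob_sum (M : POMDP X A Z) (x : X) : ∑ z, M.Ob x z = 1 := by
  unfold Ob
  rw [← ENNReal.toReal_sum (fun z _ => PMF.apply_ne_top _ _)]
  have h := (M.O x).tsum_coe
  rw [tsum_fintype] at h
  rw [h]; simp

theorem prop_nonneg (M : POMDP X A Z) (b : X → ℝ) (hb : ∀ x, 0 ≤ b x) (a : A) (x : X) :
    0 ≤ M.prop b a x :=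
  Finset.sum_nonneg fun y _ => mul_nonneg (hb y) ENNReal.toReal_nonneg

theorem upost_nonneg (M : POMDP X A Z) (b : X → ℝ) (hb : ∀ x, 0 ≤ b x) (a : A) (z : Z) (x : X) :
    0 ≤ M.upost b a z x :=
  mul_nonneg (M.Ob_nonneg x z) (M.prop_nonneg b hb a x)

theorem obsLik_eq (M : POMDP X A Z) (b : X → ℝ) (a : A) (z : Z) :
    M.obsLik z b a = ∑ x, M.upost b a z x := by
  unfold obsLik upost
  exact Finset.sum_congr rfl fun x _ => mul_comm _ _

theorem obsLik_nonneg (M : POMDP X A Z) (b : X → ℝ) (hb : ∀ x, 0 ≤ b x) (a : A) (z : Z) :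
    0 ≤ M.obsLik z b a := by
  rw [obsLik_eq]
  exact Finset.sum_nonneg fun x _ => M.upost_nonneg b hb a z x

theorem post_nonneg (M : POMDP X A Z) (b : X → ℝ) (hb : ∀ x, 0 ≤ b x) (a : A) (z : Z) (x : X) :
    0 ≤ M.post b a z x :=
  div_nonneg (M.upost_nonneg b hb a z x) (M.obsLik_nonneg b hb a z)

theorem delta_nonneg (x' x : X) : 0 ≤ delta x' x := by
  unfold delta; split_ifs <;> norm_num

theorem Rew_sum (M : POMDP X A Z) {ι : Type} (s : Finset ι) (w : ι → X → ℝ) (a : A) :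
    M.Rew (fun x => ∑ i ∈ s, w i x) a = ∑ i ∈ s, M.Rew (w i) a := by
  unfold Rew
  rw [Finset.sum_comm]
  exact Finset.sum_congr rfl fun x _ => Finset.sum_mul _ _ _

theorem prop_sum (M : POMDP X A Z) {ι : Type} (s : Finset ι) (w : ι → X → ℝ) (a : A) (x' : X) :
    M.prop (fun x => ∑ i ∈ s, w i x) a x' = ∑ i ∈ s, M.prop (w i) a x' := by
  unfold prop
  rw [Finset.sum_comm]
  exact Finset.sum_congr rfl fun x _ => Finset.sum_mul _ _ _

theorem upost_sum (M : POMDP X A Z) {ι : Type} (s : Finset ι) (w : ι → X → ℝ) (a : A) (z : Z) :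
    M.upost (fun x => ∑ i ∈ s, w i x) a z = fun x' => ∑ i ∈ s, M.upost (w i) a z x' := by
  funext x'
  unfold upost
  rw [prop_sum, Finset.mul_sum]

theorem Rew_smul (M : POMDP X A Z) (c : ℝ) (b : X → ℝ) (a : A) :
    M.Rew (fun x => c * b x) a = c * M.Rew b a := by
  unfold Rew
  rw [Finset.mul_sum]
  exact Finset.sum_congr rfl fun x _ => mul_assoc _ _ _

theorem upost_smul (M : POMDP X A Z) (c : ℝ) (b : X → ℝ) (a : A) (z : Z) :
    M.upost (fun x => c * b x) a z = fun x => c * M.upost b a z x := by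
  funext x'
  unfold upost prop
  rw [mul_left_comm, Finset.mul_sum (a := c)]
  simp only [mul_assoc]

theorem S_sum_le (M : POMDP X A Z) (n : ℕ) : ∀ {ι : Type} (s : Finset ι) (w : ι → X → ℝ),
    M.S n (fun x => ∑ i ∈ s, w i x) ≤ ∑ i ∈ s, M.S n (w i) := by
  induction n with
  | zero => intro ι s w; simp [S]
  | succ n ih =>
    intro ι s w
    rw [S]
    refine Finset.sup'_le _ _ fun a _ => ?_
    rw [Rew_sum]
    calc _ ≤ ∑ i ∈ s, M.Rew (w i) a + ∑ z, ∑ i ∈ s, M.S n (M.upost (w i) a z) := by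
          gcongr with z
          rw [upost_sum]
          exact ih s _
      _ = ∑ i ∈ s, (M.Rew (w i) a + ∑ z, M.S n (M.upost (w i) a z)) := by
          rw [Finset.sum_comm, Finset.sum_add_distrib]
      _ ≤ _ := by
          refine Finset.sum_le_sum fun i _ => ?_
          rw [S]
          exact Finset.le_sup' (fun a => M.Rew (w i) a + ∑ z, M.S n (M.upost (w i) a z))
            (Finset.mem_univ a)

theorem S_smul (M : POMDP X A Z) (n : ℕ) : ∀ (c : ℝ) (_ : 0 ≤ c) (b : X → ℝ),
    M.S n (fun x => c * b x) = c * M.S n b := by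
  induction n with
  | zero => intro c _ b; simp [S]
  | succ n ih =>
    intro c hc b
    rw [S, S, Finset.mul₀_sup' hc]
    refine Finset.sup'_congr _ rfl fun a _ => ?_
    simp only [Rew_smul, upost_smul, ih c hc, mul_add, Finset.mul_sum]

theorem sum_obs_eq (M : POMDP X A Z) (n : ℕ) (b : X → ℝ) (hb : ∀ x, 0 ≤ b x) (a : A)
    (ih : ∀ b : X → ℝ, (∀ x, 0 ≤ b x) → M.V n b = M.S n b) :
    ∑ z ∈ Finset.univ.filter (fun z => 0 < M.obsLik z b a),
      M.obsLik z b a * M.V n (M.post b a z) = ∑ z, M.S n (M.upost b a z) := by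
  rw [Finset.sum_filter]
  refine Finset.sum_congr rfl fun z _ => ?_
  split_ifs with h
  · rw [ih _ (M.post_nonneg b hb a z), ← S_smul M n _ h.le]
    congr 1
    funext x
    unfold post upost
    field_simp
  · have h0 : M.obsLik z b a = 0 := le_antisymm (not_lt.mp h) (M.obsLik_nonneg b hb a z)
    rw [obsLik_eq, Finset.sum_eq_zero_iff_of_nonneg
      (fun x _ => M.upost_nonneg b hb a z x)] at h0
    have h1 : M.upost b a z = fun x => (0 : ℝ) * M.upost b a z x := by
      funext x; rw [h0 x (Finset.mem_univ x)]; simp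
    rw [h1, S_smul M n 0 le_rfl, zero_mul]

theorem V_eq_S (M : POMDP X A Z) (n : ℕ) : ∀ b : X → ℝ, (∀ x, 0 ≤ b x) → M.V n b = M.S n b := by
  induction n with
  | zero => intro b _; simp [S, V]
  | succ n ih =>
    intro b hb
    rw [S, V]
    refine Finset.sup'_congr _ rfl fun a _ => ?_
    rw [sum_obs_eq M n b hb a ih]

theorem sum_obs_le (M : POMDP X A Z) (n : ℕ) (b : X → ℝ) (hb : ∀ x, 0 ≤ b x) (a : A) :
    ∑ z ∈ Finset.univ.filter (fun z => 0 < M.obsLik z b a),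
      M.obsLik z b a * M.V n (M.post b a z) ≤ ∑ x', M.prop b a x' * M.V n (delta x') := by
  rw [sum_obs_eq M n b hb a (M.V_eq_S n)]
  calc _ ≤ ∑ z, ∑ x', M.upost b a z x' * M.S n (delta x') := by
        refine Finset.sum_le_sum fun z _ => ?_
        have h : M.upost b a z = fun x => ∑ x', M.upost b a z x' * delta x' x := by
          funext x; simp [delta]
        conv_lhs => rw [h]
        refine (M.S_sum_le n Finset.univ (fun x' x => M.upost b a z x' * delta x' x)).trans_eq ?_
        exact Finset.sum_congr rfl fun x' _ => M.S_smul n _ (M.upost_nonneg b hb a z x') _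
    _ = _ := by
        rw [Finset.sum_comm]
        refine Finset.sum_congr rfl fun x' _ => ?_
        rw [M.V_eq_S n _ (delta_nonneg x'), ← Finset.sum_mul]
        unfold upost
        rw [← Finset.sum_mul, Ob_sum, one_mul]

theorem step_le (M : POMDP X A Z) (β : List (A ⊕ (Z ⊕ X)) → Bool) (n : ℕ)
    (ih : ∀ (b : X → ℝ) (_ : ∀ x, 0 ≤ b x) h, M.V n b ≤ M.VAFO β n b h)
    (b : X → ℝ) (hb : ∀ x, 0 ≤ b x) (a : A) (h : List (A ⊕ (Z ⊕ X))) :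
    M.Q (n + 1) b a ≤ M.QAFO β (n + 1) b a h := by
  rw [Q, QAFO]
  refine add_le_add le_rfl ?_
  split_ifs
  · refine (M.sum_obs_le n b hb a).trans (Finset.sum_le_sum fun x' _ => ?_)
    exact mul_le_mul_of_nonneg_left (ih _ (delta_nonneg x') _) (M.prop_nonneg b hb a x')
  · refine Finset.sum_le_sum fun z _ => ?_
    exact mul_le_mul_of_nonneg_left (ih _ (M.post_nonneg b hb a z) _) (M.obsLik_nonneg b hb a z)

theorem V_le_VAFO (M : POMDP X A Z) (β : List (A ⊕ (Z ⊕ X)) → Bool) (n : ℕ) :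
    ∀ (b : X → ℝ) (_ : ∀ x, 0 ≤ b x) h, M.V n b ≤ M.VAFO β n b h := by
  induction n with
  | zero => intro b _ h; simp [V, VAFO]
  | succ n ih =>
    intro b hb h
    rw [V, VAFO]
    exact Finset.sup'_mono_fun fun a _ => M.step_le β n ih b hb a h

end Aux

end POMDP

/-- upper-bound half of Theorem 1: for every finite POMDP,
topology `β` on histories, horizon `L ≥ 1`, belief `b₀` and action `a₀`, the
closed-loop optimal Q-value is upper-bounded by the adaptive fully-observable
optimal Q-value at the empty history. -/
theorem Q_le_afo_Q {X A Z : Type} [Fintype X] [Fintype A] [Fintype Z]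
    [Nonempty X] [Nonempty A] [Nonempty Z]
    (M : POMDP X A Z) (β : List (A ⊕ (Z ⊕ X)) → Bool)
    (L : ℕ) (hL : 1 ≤ L)
    (b₀ : X → ℝ) (hb₀ : POMDP.IsBelief b₀) (a₀ : A) :
    M.Q L b₀ a₀ ≤ M.QAFO β L b₀ a₀ [] := by
  obtain ⟨n, rfl⟩ : ∃ n, L = n + 1 := ⟨L - 1, by omega⟩
  exact M.step_le β n (M.V_le_VAFO β n) b₀ hb₀.1 a₀ []
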